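/- (Proposition) The stable set of the origin for f equals W̃: W^s_f(0,0,0) = ⋃_{k∈ℤ} E_k ∪ {(x,0,0) : x ∈ ℝ}. -/

import Mathlib

noncomputable section

open Set Filter Topology

/-- `T₁(x,y,z) = (x/2, 2y, 2z)`. -/
def T1 : ℝ × ℝ × ℝ → ℝ × ℝ × ℝ := fun v => (v.1 / 2, 2 * v.2.1, 2 * v.2.2)

/-- `T₂(x,y,z) = (x/2, y/2, z/2)`. -/
def T2 : ℝ × ℝ × ℝ → ℝ × ℝ × ℝ := fun v => (v.1 / 2, v.2.1 / 2, v.2.2 / 2)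

/-- The `n`-th power (`n ∈ ℤ`) of `T₂`: `T₂ⁿ(v) = 2⁻ⁿ • v`. -/
def T2pow (n : ℤ) : ℝ × ℝ × ℝ → ℝ × ℝ × ℝ := fun v => ((2 : ℝ) ^ (-n)) • v

/-- The closed (Euclidean) ball `B` of radius `r` centered at `(3/2, 0, 0)`. -/
def Bset (r : ℝ) : Set (ℝ × ℝ × ℝ) :=
  {v | (v.1 - 3 / 2) ^ 2 + v.2.1 ^ 2 + v.2.2 ^ 2 ≤ r ^ 2}

/-- `B_n = T₂ⁿ(B)` for `n ∈ ℤ`. -/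
def Bn (r : ℝ) (n : ℤ) : Set (ℝ × ℝ × ℝ) := T2pow n '' Bset r

/-- The continuum `E`: the union of the segment `[3/2 - r/2, 3/2 + r/2] × {0} × {0}`,
the segment `{3/2 - r/2} × [0, r/2] × {0}`, and the segments
`{3/2 - r/2 + r/k} × [0, r/2] × {0}` for integers `k ≥ 1`. -/
def Eset (r : ℝ) : Set (ℝ × ℝ × ℝ) :=
  {v | v.1 ∈ Icc (3 / 2 - r / 2) (3 / 2 + r / 2) ∧ v.2.1 = 0 ∧ v.2.2 = 0} ∪
  {v | v.1 = 3 / 2 - r / 2 ∧ v.2.1 ∈ Icc 0 (r / 2) ∧ v.2.2 = 0} ∪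
  {v | ∃ k : ℕ, 1 ≤ k ∧ v.1 = 3 / 2 - r / 2 + r / (k : ℝ) ∧ v.2.1 ∈ Icc 0 (r / 2) ∧ v.2.2 = 0}

/-- `E_k = T₂ᵏ(E)` for `k ∈ ℤ`. -/
def Ek (r : ℝ) (k : ℤ) : Set (ℝ × ℝ × ℝ) := T2pow k '' Eset r

/-- `W̃ = ⋃_{k ∈ ℤ} E_k ∪ {(x,0,0) : x ∈ ℝ}`. -/
def Wtilde (r : ℝ) : Set (ℝ × ℝ × ℝ) :=
  (⋃ k : ℤ, Ek r k) ∪ {v | v.2.1 = 0 ∧ v.2.2 = 0}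

/-- The (global) stable set `W^s_f(a) = {b : ‖fⁿ(a) - fⁿ(b)‖ → 0 as n → +∞}`. -/
def Ws (f : ℝ × ℝ × ℝ → ℝ × ℝ × ℝ) (a : ℝ × ℝ × ℝ) : Set (ℝ × ℝ × ℝ) :=
  {b | Tendsto (fun n : ℕ => ‖f^[n] a - f^[n] b‖) atTop (𝓝 0)}

theorem aux_ge (w q : ℝ → ℝ) (hw : ∀ t, HasDerivAt w (-(q t * w t * Real.log 4)) t)
    (a b c : ℝ) (hab : a ≤ b) (hpos : ∀ t ∈ Icc a b, 0 < w t) (hq : ∀ t ∈ Icc a b, q t ≤ c) :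
    w a * Real.exp (-(c * Real.log 4 * (b - a))) ≤ w b := by
  have hd : ∀ t, HasDerivAt (fun t => w t * Real.exp (c * Real.log 4 * t))
      (-(q t * w t * Real.log 4) * Real.exp (c * Real.log 4 * t) +
        w t * (Real.exp (c * Real.log 4 * t) * (c * Real.log 4 * 1))) t := fun t =>
    (hw t).mul (((hasDerivAt_id t).const_mul (c * Real.log 4)).exp)
  have hm : MonotoneOn (fun t => w t * Real.exp (c * Real.log 4 * t)) (Icc a b) := by
    apply monotoneOn_of_deriv_nonneg (convex_Icc a b)
    · exact fun t _ => (hd t).continuousAt.continuousWithinAt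
    · exact fun t _ => (hd t).differentiableAt.differentiableWithinAt
    · intro t ht
      have ht' := interior_subset ht
      rw [(hd t).deriv]
      have h1 := hpos t ht'
      have h2 := hq t ht'
      have h3 : 0 < Real.log 4 := Real.log_pos (by norm_num)
      have : 0 ≤ (c - q t) * w t * Real.log 4 * Real.exp (c * Real.log 4 * t) := by
        have : 0 ≤ c - q t := by linarith
        positivity
      linarith
  have h := hm (left_mem_Icc.2 hab) (right_mem_Icc.2 hab) hab
  simp only at h
  have e : Real.exp (-(c * Real.log 4 * (b - a))) =
      Real.exp (c * Real.log 4 * a) * Real.exp (-(c * Real.log 4 * b)) := by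
    rw [← Real.exp_add]; ring_nf
  have e2 : Real.exp (c * Real.log 4 * b) * Real.exp (-(c * Real.log 4 * b)) = 1 := by
    rw [← Real.exp_add]; simp
  calc _ = w a * Real.exp (c * Real.log 4 * a) * Real.exp (-(c * Real.log 4 * b)) := by
        rw [e]; ring
    _ ≤ w b * Real.exp (c * Real.log 4 * b) * Real.exp (-(c * Real.log 4 * b)) := by gcongr
    _ = w b := by rw [mul_assoc, e2, mul_one]

theorem aux_le (w q : ℝ → ℝ) (hw : ∀ t, HasDerivAt w (-(q t * w t * Real.log 4)) t)
    (a b c : ℝ) (hab : a ≤ b) (hpos : ∀ t ∈ Icc a b, 0 < w t) (hq : ∀ t ∈ Icc a b, c ≤ q t) :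
    w b ≤ w a * Real.exp (-(c * Real.log 4 * (b - a))) := by
  have hd : ∀ t, HasDerivAt (fun t => w t * Real.exp (c * Real.log 4 * t))
      (-(q t * w t * Real.log 4) * Real.exp (c * Real.log 4 * t) +
        w t * (Real.exp (c * Real.log 4 * t) * (c * Real.log 4 * 1))) t := fun t =>
    (hw t).mul (((hasDerivAt_id t).const_mul (c * Real.log 4)).exp)
  have hm : AntitoneOn (fun t => w t * Real.exp (c * Real.log 4 * t)) (Icc a b) := by
    apply antitoneOn_of_deriv_nonpos (convex_Icc a b)
    · exact fun t _ => (hd t).continuousAt.continuousWithinAt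
    · exact fun t _ => (hd t).differentiableAt.differentiableWithinAt
    · intro t ht
      have ht' := interior_subset ht
      rw [(hd t).deriv]
      have h1 := hpos t ht'
      have h2 := hq t ht'
      have h3 : 0 < Real.log 4 := Real.log_pos (by norm_num)
      have : 0 ≤ (q t - c) * w t * Real.log 4 * Real.exp (c * Real.log 4 * t) := by
        have : 0 ≤ q t - c := by linarith
        positivity
      linarith
  have h := hm (left_mem_Icc.2 hab) (right_mem_Icc.2 hab) hab
  simp only at h
  have e : Real.exp (-(c * Real.log 4 * (b - a))) =
      Real.exp (c * Real.log 4 * a) * Real.exp (-(c * Real.log 4 * b)) := by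
    rw [← Real.exp_add]; ring_nf
  have e2 : Real.exp (c * Real.log 4 * b) * Real.exp (-(c * Real.log 4 * b)) = 1 := by
    rw [← Real.exp_add]; simp
  calc w b = w b * Real.exp (c * Real.log 4 * b) * Real.exp (-(c * Real.log 4 * b)) := by
        rw [mul_assoc, e2, mul_one]
    _ ≤ w a * Real.exp (c * Real.log 4 * a) * Real.exp (-(c * Real.log 4 * b)) := by gcongr
    _ = _ := by rw [e]; ring

theorem aux_sq (w q : ℝ → ℝ) (hw : ∀ t, HasDerivAt w (-(q t * w t * Real.log 4)) t)
    (hq : ∀ t, q t ∈ Icc (0:ℝ) 1) : Antitone (fun t => w t ^ 2) ∧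
      Monotone (fun t => w t ^ 2 * Real.exp (2 * Real.log 4 * t)) := by
  have h3 : 0 < Real.log 4 := Real.log_pos (by norm_num)
  have hs : ∀ t, HasDerivAt (fun t => w t ^ 2)
      (((2 : ℕ) : ℝ) * w t ^ (2 - 1) * (-(q t * w t * Real.log 4))) t := fun t => (hw t).pow 2
  have hd : ∀ t, HasDerivAt (fun t => w t ^ 2 * Real.exp (2 * Real.log 4 * t))
      ((((2 : ℕ) : ℝ) * w t ^ (2 - 1) * (-(q t * w t * Real.log 4))) *
        Real.exp (2 * Real.log 4 * t) +
        w t ^ 2 * (Real.exp (2 * Real.log 4 * t) * (2 * Real.log 4 * 1))) t := fun t =>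
    (hs t).mul (((hasDerivAt_id t).const_mul (2 * Real.log 4)).exp)
  constructor
  · apply antitone_of_deriv_nonpos (fun t => (hs t).differentiableAt)
    intro t
    rw [(hs t).deriv]
    have := (hq t).1
    have : 0 ≤ 2 * q t * w t ^ 2 * Real.log 4 := by positivity
    norm_num
    linarith
  · apply monotone_of_deriv_nonneg (fun t => (hd t).differentiableAt)
    intro t
    rw [(hd t).deriv]
    have h1 : 0 ≤ 1 - q t := by linarith [(hq t).2]
    have : 0 ≤ 2 * (1 - q t) * w t ^ 2 * Real.log 4 * Real.exp (2 * Real.log 4 * t) := by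
      positivity
    norm_num
    linarith

theorem aux_zero (w q : ℝ → ℝ) (hw : ∀ t, HasDerivAt w (-(q t * w t * Real.log 4)) t)
    (hq : ∀ t, q t ∈ Icc (0:ℝ) 1) (h0 : w 0 = 0) : w 1 = 0 := by
  have := (aux_sq w q hw hq).1 (zero_le_one)
  simp only [h0] at this
  nlinarith

theorem aux_pos (w q : ℝ → ℝ) (hw : ∀ t, HasDerivAt w (-(q t * w t * Real.log 4)) t)
    (hq : ∀ t, q t ∈ Icc (0:ℝ) 1) (h0 : 0 < w 0) (t : ℝ) (ht : 0 ≤ t) : 0 < w t := by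
  by_contra! hn
  have hc : ContinuousOn w (Icc 0 t) := fun s _ => (hw s).continuousAt.continuousWithinAt
  obtain ⟨s, hs, hs0⟩ := intermediate_value_Icc' ht hc ⟨hn, h0.le⟩
  have := (aux_sq w q hw hq).2 hs.1
  simp only [hs0] at this
  norm_num at this
  nlinarith

theorem exp_log4 (s : ℝ) : Real.exp (-(1 * Real.log 4 * s)) = Real.exp (-(Real.log 4 * s)) := by
  simp

theorem exp_log4' : Real.exp (-(1 * Real.log 4 * (1 - 0))) = 1 / 4 := by
  rw [one_mul, sub_zero, mul_one, Real.exp_neg, Real.exp_log (by norm_num)]; norm_num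

/-- One step growth. -/
theorem aux_step (w Q : ℝ → ℝ) (hw : ∀ t, HasDerivAt w (-(Q (w t) * w t * Real.log 4)) t)
    (hq : ∀ t, Q t ∈ Icc (0:ℝ) 1) (h0 : 0 < w 0) (s ε : ℝ) (hs0 : 0 ≤ s) (hs1 : s ≤ 1)
    (h : ∀ u, w 0 * Real.exp (-(Real.log 4 * s)) ≤ u → Q u ≤ 1 - ε) :
    w 0 * Real.exp (ε * Real.log 4 * s) ≤ 4 * w 1 := by
  have hp := aux_pos w (fun t => Q (w t)) hw (fun t => hq _) h0
  have l4 : 0 < Real.log 4 := Real.log_pos (by norm_num)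
  have h1 := aux_ge w (fun t => Q (w t)) hw 0 s (1 - ε) hs0 (fun t ht => hp t ht.1) (by
    intro t ht
    apply h
    have := aux_ge w (fun t => Q (w t)) hw 0 t 1 ht.1 (fun t ht => hp t ht.1)
      (fun t _ => (hq _).2)
    rw [one_mul, sub_zero] at this
    refine le_trans ?_ this
    gcongr
    exact ht.2)
  have h2 := aux_ge w (fun t => Q (w t)) hw s 1 1 hs1 (fun t ht => hp t (hs0.trans ht.1))
      (fun t _ => (hq _).2)
  have e : Real.exp (ε * Real.log 4 * s) = 4 * (Real.exp (-((1 - ε) * Real.log 4 * (s - 0))) *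
      Real.exp (-(1 * Real.log 4 * (1 - s)))) := by
    rw [← Real.exp_add]
    nth_rewrite 2 [← Real.exp_log (show (0:ℝ) < 4 by norm_num)]
    rw [← Real.exp_add]
    ring_nf
  rw [e]
  have := mul_le_mul_of_nonneg_right h1 (Real.exp_pos (-(1 * Real.log 4 * (1 - s)))).le
  nlinarith

theorem aux_seq (Q : ℝ → ℝ) (hc : Continuous Q) (hq : ∀ t, Q t ∈ Icc (0:ℝ) 1)
    (U : ℝ) (hU : ∀ u, U < u → Q u = 0) (u : ℕ → ℝ) (hu0 : u 0 = 1)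
    (hstep : ∀ n, ∃ w : ℝ → ℝ, w 0 = u n ∧ u (n+1) = 4 * w 1 ∧
      ∀ t, HasDerivAt w (-(Q (w t) * w t * Real.log 4)) t)
    (hlim : Tendsto (fun n => u n / 2 ^ n) atTop (𝓝 0)) : ∃ a, 1 ≤ a ∧ Q a = 1 := by
  by_contra! hne
  have hlt : ∀ a, 1 ≤ a → Q a < 1 := fun a ha => lt_of_le_of_ne (hq a).2 (hne a ha)
  have l4 : 0 < Real.log 4 := Real.log_pos (by norm_num)
  -- s
  obtain ⟨s, hs0, hs1, hs⟩ : ∃ s : ℝ, 0 < s ∧ s ≤ 1 ∧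
      ∀ a, Real.exp (-(Real.log 4 * s)) ≤ a → Q a < 1 := by
    have hopen : ∀ᶠ a in 𝓝 (1:ℝ), Q a < 1 :=
      hc.continuousAt.eventually_lt continuousAt_const (hlt 1 le_rfl)
    obtain ⟨d, hd, hdd⟩ := Metric.eventually_nhds_iff.1 hopen
    have ht : Tendsto (fun s : ℝ => Real.exp (-(Real.log 4 * s))) (𝓝[>] 0) (𝓝 1) := by
      have : Continuous (fun s : ℝ => Real.exp (-(Real.log 4 * s))) := by fun_prop
      have := this.tendsto 0
      simp only [mul_zero, neg_zero, Real.exp_zero] at this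
      exact this.mono_left nhdsWithin_le_nhds
    have e1 := ht.eventually (Metric.ball_mem_nhds 1 hd)
    have e2 : ∀ᶠ s : ℝ in 𝓝[>] 0, s ∈ Ioc (0:ℝ) 1 := Ioc_mem_nhdsGT zero_lt_one
    obtain ⟨s, h1, h2⟩ := (e1.and e2).exists
    refine ⟨s, h2.1, h2.2, fun a ha => ?_⟩
    by_cases h : 1 ≤ a
    · exact hlt a h
    · apply hdd
      rw [Real.dist_eq, abs_lt] at h1
      rw [Real.dist_eq, abs_lt]
      constructor <;> linarith
  obtain ⟨ε, he0, he⟩ : ∃ ε : ℝ, 0 < ε ∧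
      ∀ a, Real.exp (-(Real.log 4 * s)) ≤ a → Q a ≤ 1 - ε := by
    obtain ⟨m, hm, hmm⟩ := (isCompact_Icc (a := Real.exp (-(Real.log 4 * s)))
      (b := max U 1)).exists_isMaxOn ⟨max U 1, by
        constructor
        · refine le_trans ?_ (le_max_right _ _)
          rw [Real.exp_le_one_iff]
          have : 0 < Real.log 4 * s := by positivity
          linarith
        · exact le_rfl⟩ hc.continuousOn
    have := hs m hm.1
    refine ⟨1 - Q m, by linarith, fun a ha => ?_⟩
    by_cases h : a ≤ max U 1
    · have := hmm ⟨ha, h⟩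
      change Q a ≤ Q m at this
      linarith
    · rw [hU a (lt_of_le_of_lt (le_max_left _ _) (not_le.1 h))]
      linarith [(hq m).1]
  set K := Real.exp (ε * Real.log 4 * s) with hK
  have hK1 : 1 < K := by rw [hK, Real.one_lt_exp_iff]; positivity
  have hgrow : ∀ n, K ^ n ≤ u n := by
    intro n
    induction n with
    | zero => simp [hu0]
    | succ n ih =>
      obtain ⟨w, hw0, hw1, hw⟩ := hstep n
      have h1 : 1 ≤ u n := (one_le_pow₀ hK1.le).trans ih
      have := aux_step w Q hw hq (by rw [hw0]; linarith) s ε hs0.le hs1 (by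
        intro a ha
        apply he
        refine le_trans ?_ ha
        rw [hw0]
        exact le_mul_of_one_le_left (Real.exp_pos _).le h1)
      rw [← hK, hw0] at this
      rw [hw1, pow_succ]
      refine le_trans ?_ this
      gcongr
  obtain ⟨N, hN⟩ := ((tendsto_pow_atTop_atTop_of_one_lt hK1).eventually_gt_atTop (4 * U)).exists
  have hbig : ∀ m, 4 ^ m * max 1 (K ^ N) ≤ u (N + m) := by
    intro m
    have hKN : 1 ≤ K ^ N := one_le_pow₀ hK1.le
    rw [max_eq_right hKN]
    induction m with
    | zero => simpa using hgrow N
    | succ m ih =>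
      obtain ⟨w, hw0, hw1, hw⟩ := hstep (N + m)
      have h4 : (1:ℝ) ≤ 4 ^ m := one_le_pow₀ (by norm_num)
      have h5 : K ^ N ≤ u (N + m) := by nlinarith
      have := aux_step w Q hw hq (by rw [hw0]; linarith) 1 1 zero_le_one le_rfl (by
        intro a ha
        rw [hU]
        · norm_num
        · rw [hw0, mul_one, Real.exp_neg, Real.exp_log (by norm_num)] at ha
          linarith)
      rw [one_mul, mul_one, Real.exp_log (by norm_num), hw0] at this
      rw [← add_assoc, hw1, pow_succ]
      nlinarith
  have hev := hlim.comp (tendsto_add_atTop_nat N)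
  have hev := hev.eventually (gt_mem_nhds (show (0:ℝ) < 1 / 2 ^ N by positivity))
  obtain ⟨m, hm⟩ := hev.exists
  simp only [Function.comp] at hm
  have h1 := hbig m
  rw [add_comm N m] at h1
  rw [pow_add, div_lt_div_iff₀ (by positivity) (by positivity)] at hm
  have h2 : (4:ℝ) ^ m ≤ u (m + N) := le_trans (le_mul_of_one_le_right (by positivity) (le_max_left _ _)) h1
  have h3 : (2:ℝ) ^ m ≤ 4 ^ m := by gcongr; norm_num
  have h4 : (0:ℝ) < 2 ^ N := by positivity
  nlinarith

theorem aux_const (Q : ℝ → ℝ) (hq : ∀ t, Q t ∈ Icc (0:ℝ) 1) (h : ∀ t ∈ Icc (0:ℝ) 1, Q t = 1)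
    (w : ℝ → ℝ) (hw0 : w 0 = 1) 
    (hw : ∀ t, HasDerivAt w (-(Q (w t) * w t * Real.log 4)) t) : 4 * w 1 = 1 := by
  have hp := aux_pos w (fun t => Q (w t)) hw (fun t => hq _) (by rw [hw0]; norm_num)
  have h1 : ∀ t ∈ Icc (0:ℝ) 1, w t ≤ 1 := by
    intro t ht
    have := (aux_sq w (fun t => Q (w t)) hw (fun t => hq _)).1 ht.1
    simp only [hw0] at this
    nlinarith [hp t ht.1]
  have h2 := aux_ge w (fun t => Q (w t)) hw 0 1 1 zero_le_one (fun t ht => hp t ht.1)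
    (fun t _ => (hq _).2)
  have h3 := aux_le w (fun t => Q (w t)) hw 0 1 1 zero_le_one (fun t ht => hp t ht.1)
    (fun t ht => (h _ ⟨(hp t ht.1).le, h1 t ht⟩).ge)
  rw [exp_log4', hw0] at h2 h3
  linarith

theorem Eset_x (r : ℝ) (hr : r ∈ Ioo (0 : ℝ) (1 / 2)) (v : ℝ × ℝ × ℝ) (hv : v ∈ Eset r) :
    1 < v.1 ∧ v.1 < 2 ∧ v.2.2 = 0 := by
  obtain ⟨h0, h1⟩ := hr
  rcases hv with (⟨⟨ha, hb⟩, hc, hd⟩ | ⟨ha, hb, hd⟩) | ⟨k, hk, ha, hb, hd⟩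
  · exact ⟨by linarith, by linarith, hd⟩
  · exact ⟨by linarith, by linarith, hd⟩
  · have hk' : (1:ℝ) ≤ k := by exact_mod_cast hk
    have h2 : 0 < r / k := by positivity
    have h3 : r / k ≤ r := div_le_self h0.le hk'
    exact ⟨by linarith, by linarith, hd⟩

theorem Eset_vert (r : ℝ) (x y z t : ℝ) (ht : t ∈ Icc (0:ℝ) 1)
    (hv : (x, y, z) ∈ Eset r) : (x, t * y, z) ∈ Eset r := by
  obtain ⟨h0, h1⟩ := ht
  rcases hv with (⟨hx, hc, hd⟩ | ⟨ha, hb, hd⟩) | ⟨k, hk, ha, hb, hd⟩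
  · refine Or.inl (Or.inl ⟨hx, ?_, hd⟩)
    simp only at hc
    simp [hc]
  · refine Or.inl (Or.inr ⟨ha, ?_, hd⟩)
    simp only [mem_Icc] at hb ⊢
    exact ⟨mul_nonneg h0 hb.1, by nlinarith⟩
  · refine Or.inr ⟨k, hk, ha, ?_, hd⟩
    simp only [mem_Icc] at hb ⊢
    exact ⟨mul_nonneg h0 hb.1, by nlinarith⟩

theorem mem_T2img (S : Set (ℝ × ℝ × ℝ)) (k : ℤ) (x y z : ℝ) : (x, y, z) ∈ T2pow k '' S ↔
    ((2:ℝ) ^ k * x, (2:ℝ) ^ k * y, (2:ℝ) ^ k * z) ∈ S := by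
  have h : (2:ℝ) ^ k ≠ 0 := by positivity
  constructor
  · rintro ⟨⟨a, b, c⟩, hv, he⟩
    simp only [T2pow, Prod.smul_mk, smul_eq_mul, Prod.mk.injEq, zpow_neg] at he
    obtain ⟨rfl, rfl, rfl⟩ := he
    simpa [h] using hv
  · intro hv
    refine ⟨_, hv, ?_⟩
    simp [T2pow, h]

theorem Ek_vert (r : ℝ) (k : ℤ) (x y z t : ℝ) (ht : t ∈ Icc (0:ℝ) 1)
    (hv : (x, y, z) ∈ Ek r k) : (x, t * y, z) ∈ Ek r k := by
  rw [Ek, mem_T2img] at hv ⊢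
  have := Eset_vert r _ _ _ t ht hv
  rwa [mul_left_comm] at this

theorem Ek_z (r : ℝ) (hr : r ∈ Ioo (0 : ℝ) (1 / 2)) (k : ℤ) (x y z : ℝ)
    (hv : (x, y, z) ∈ Ek r k) : z = 0 := by
  rw [Ek, mem_T2img] at hv
  have := (Eset_x r hr _ hv).2.2
  have h : (2:ℝ) ^ k ≠ 0 := by positivity
  simpa [h] using this

theorem zpow_uniq (x : ℝ) (k n : ℤ) (h1 : 1 ≤ (2:ℝ) ^ k * x) (h2 : (2:ℝ) ^ k * x < 2)
    (h3 : 1 ≤ (2:ℝ) ^ n * x) (h4 : (2:ℝ) ^ n * x < 2) : n = k := by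
  have key : ∀ k n : ℤ, 1 ≤ (2:ℝ) ^ k * x → (2:ℝ) ^ n * x < 2 → n ≤ k := by
    intro k n h1 h4
    by_contra! h
    have hk : (0:ℝ) < 2 ^ k := by positivity
    have hx : 0 < x := by
      by_contra! hx
      nlinarith
    have : (2:ℝ) ^ (k + 1) ≤ 2 ^ n := zpow_le_zpow_right₀ (by norm_num) (by omega)
    rw [zpow_add_one₀ (by norm_num)] at this
    nlinarith
  exact le_antisymm (key k n h1 h4) (key n k h3 h2)

theorem Bset_x (r : ℝ) (hr : r ∈ Ioo (0 : ℝ) (1 / 2)) (v : ℝ × ℝ × ℝ) (hv : v ∈ Bset r) :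
    1 < v.1 ∧ v.1 < 2 ∧ |v.2.1| < 1 := by
  obtain ⟨h0, h1⟩ := hr
  have hv : (v.1 - 3 / 2) ^ 2 + v.2.1 ^ 2 + v.2.2 ^ 2 ≤ r ^ 2 := hv
  refine ⟨?_, ?_, ?_⟩
  · nlinarith [sq_nonneg v.2.1, sq_nonneg v.2.2]
  · nlinarith [sq_nonneg v.2.1, sq_nonneg v.2.2]
  · rw [abs_lt]
    constructor <;> nlinarith [sq_nonneg (v.1 - 3 / 2), sq_nonneg v.2.2]

theorem exists_P (r : ℝ) (hr : r ∈ Ioo (0 : ℝ) (1 / 2))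
    (ρ : ℝ × ℝ × ℝ → ℝ) (hρs : Continuous ρ) (hρ01 : ∀ v, ρ v ∈ Icc (0 : ℝ) 1)
    (hρE : ρ ⁻¹' {1} = Eset r) (hρ0 : ∀ v ∉ interior (Bset r), ρ v = 0)
    (X : ℝ × ℝ × ℝ → ℝ × ℝ × ℝ)
    (hX : ∀ n : ℤ, ∀ v ∈ Bn r n, X v = (0, -(ρ (T2pow (-n) v) * v.2.1 * Real.log 4), 0))
    (hX0 : ∀ v : ℝ × ℝ × ℝ, (∀ n : ℤ, v ∉ Bn r n) → X v = 0) (x : ℝ) :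
    ∃ P : ℝ → ℝ, Continuous P ∧ (∀ y, P y ∈ Icc (0:ℝ) 1) ∧ (∃ U, ∀ y, U < |y| → P y = 0) ∧
      (∀ y, P y = 1 ↔ ∃ k, (x, y, 0) ∈ Ek r k) ∧
      ∀ (n : ℕ) (y : ℝ), X (x / 2 ^ n, y, 0) = (0, -(P (2 ^ n * y) * y * Real.log 4), 0) := by
  have hE : ∀ v, ρ v = 1 ↔ v ∈ Eset r := fun v => by rw [← hρE]; rfl
  rcases le_or_gt x 0 with hx | hx
  · refine ⟨fun _ => 0, continuous_const, fun _ => by simp, ⟨0, fun _ _ => rfl⟩, ?_, ?_⟩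
    · intro y
      simp only [zero_ne_one, false_iff, not_exists]
      intro k hk
      rw [Ek, mem_T2img] at hk
      have h1 := (Eset_x r hr _ hk).1
      have h2 : (0:ℝ) < 2 ^ k := by positivity
      simp only at h1
      nlinarith
    · intro n y
      rw [hX0]
      · simp
        rfl
      · intro m hm
        rw [Bn, mem_T2img] at hm
        have h1 := (Bset_x r hr _ hm).1
        have h2 : (0:ℝ) < 2 ^ m := by positivity
        have h3 : x / 2 ^ n ≤ 0 := div_nonpos_of_nonpos_of_nonneg hx (by positivity)
        simp only at h1
        nlinarith
  · obtain ⟨j, hj⟩ := exists_mem_Ico_zpow hx (one_lt_two (α := ℝ))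
    obtain ⟨k, rfl⟩ : ∃ k, j = -k := ⟨-j, by simp⟩
    have hk0 : (0:ℝ) < 2 ^ k := by positivity
    have h1 : 1 ≤ (2:ℝ) ^ k * x := by
      have := mul_le_mul_of_nonneg_left hj.1 hk0.le
      rwa [← zpow_add₀ (by norm_num), add_neg_cancel, zpow_zero] at this
    have h2 : (2:ℝ) ^ k * x < 2 := by
      have := mul_lt_mul_of_pos_left hj.2 hk0
      rwa [← zpow_add₀ (by norm_num), add_neg_cancel_left, zpow_one] at this
    refine ⟨fun y => ρ ((2:ℝ) ^ k * x, (2:ℝ) ^ k * y, (2:ℝ) ^ k * 0), by fun_prop,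
      fun _ => hρ01 _, ⟨2 ^ (-k), ?_⟩, ?_, ?_⟩
    · intro y hy
      apply hρ0
      intro hm
      have h := (Bset_x r hr _ (interior_subset hm)).2.2
      simp only [abs_mul, abs_of_pos hk0] at h
      have := mul_lt_mul_of_pos_left hy hk0
      rw [← zpow_add₀ (by norm_num), add_neg_cancel, zpow_zero] at this
      linarith
    · intro y
      rw [hE]
      constructor
      · intro h
        exact ⟨k, by rw [Ek, mem_T2img]; exact h⟩
      · rintro ⟨m, hm⟩
        rw [Ek, mem_T2img] at hm
        obtain ⟨h3, h4, -⟩ := Eset_x r hr _ hm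
        obtain rfl := zpow_uniq x k m h1 h2 h3.le h4
        exact hm
    · intro n y
      have hn : (0:ℝ) < 2 ^ n := by positivity
      have e : (2:ℝ) ^ (k + n) * (x / 2 ^ n) = 2 ^ k * x := by
        rw [zpow_add₀ (by norm_num), zpow_natCast]; field_simp
      have e' : (2:ℝ) ^ (k + n) * y = 2 ^ k * (2 ^ n * y) := by
        rw [zpow_add₀ (by norm_num), zpow_natCast]; ring
      by_cases hB : ∃ m, (x / 2 ^ n, y, (0:ℝ)) ∈ Bn r m
      · obtain ⟨m, hm⟩ := hB
        rw [hX m _ hm]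
        rw [Bn, mem_T2img] at hm
        obtain ⟨h3, h4, -⟩ := Bset_x r hr _ hm
        obtain rfl := zpow_uniq (x / 2 ^ n) (k + n) m (by rwa [e]) (by rwa [e]) h3.le h4
        simp only [T2pow, Prod.smul_mk, smul_eq_mul, neg_neg, e, e', mul_zero]
      · push Not at hB
        rw [hX0 _ hB]
        have := hB (k + n)
        rw [Bn, mem_T2img, e, e'] at this
        simp only [mul_zero] at this ⊢
        rw [hρ0 _ (fun h => this (interior_subset h))]
        simp
        rfl

/-- Proposition: the stable set of the origin for `f = T₁ ∘ φ₁` equals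
`W̃ = ⋃_{k ∈ ℤ} E_k ∪ {(x,0,0) : x ∈ ℝ}`. -/
theorem stmt_17 (r : ℝ) (hr : r ∈ Ioo (0 : ℝ) (1 / 2))
    (ρ : ℝ × ℝ × ℝ → ℝ) (hρs : ContDiff ℝ (⊤ : ℕ∞) ρ) (hρ01 : ∀ v, ρ v ∈ Icc (0 : ℝ) 1)
    (hρE : ρ ⁻¹' {1} = Eset r) (hρ0 : ∀ v ∉ interior (Bset r), ρ v = 0)
    (X : ℝ × ℝ × ℝ → ℝ × ℝ × ℝ)
    (hX : ∀ n : ℤ, ∀ v ∈ Bn r n, X v = (0, -(ρ (T2pow (-n) v) * v.2.1 * Real.log 4), 0))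
    (hX0 : ∀ v : ℝ × ℝ × ℝ, (∀ n : ℤ, v ∉ Bn r n) → X v = 0)
    (φ : ℝ → ℝ × ℝ × ℝ → ℝ × ℝ × ℝ)
    (hφ0 : ∀ v, φ 0 v = v)
    (hφd : ∀ (v : ℝ × ℝ × ℝ) (t : ℝ), HasDerivAt (fun s => φ s v) (X (φ t v)) t)
    (f : ℝ × ℝ × ℝ → ℝ × ℝ × ℝ) (hf : ∀ v, f v = T1 (φ 1 v)) :
    Ws f ((0, 0, 0) : ℝ × ℝ × ℝ) = Wtilde r := by
  have hXx : ∀ v, (X v).1 = 0 ∧ (X v).2.2 = 0 := by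
    intro v
    by_cases hB : ∃ m, v ∈ Bn r m
    · obtain ⟨m, hm⟩ := hB
      rw [hX m v hm]
      exact ⟨rfl, rfl⟩
    · push Not at hB
      rw [hX0 v hB]
      exact ⟨rfl, rfl⟩
  have hd1 : ∀ v t, HasDerivAt (fun s => (φ s v).1) (X (φ t v)).1 t := fun v t =>
    (hφd v t).fst
  have hd2 : ∀ v t, HasDerivAt (fun s => (φ s v).2.1) (X (φ t v)).2.1 t := fun v t =>
    (hφd v t).snd.fst
  have hd3 : ∀ v t, HasDerivAt (fun s => (φ s v).2.2) (X (φ t v)).2.2 t := fun v t =>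
    (hφd v t).snd.snd
  have hx : ∀ v t, (φ t v).1 = v.1 := by
    intro v t
    have := is_const_of_deriv_eq_zero (fun t => (hd1 v t).differentiableAt)
      (fun t => by rw [(hd1 v t).deriv, (hXx _).1]) t 0
    simpa [hφ0] using this
  have hz : ∀ v t, (φ t v).2.2 = v.2.2 := by
    intro v t
    have := is_const_of_deriv_eq_zero (fun t => (hd3 v t).differentiableAt)
      (fun t => by rw [(hd3 v t).deriv, (hXx _).2]) t 0
    simpa [hφ0] using this
  have itx : ∀ v (n : ℕ), (f^[n] v).1 = v.1 / 2 ^ n := by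
    intro v n
    induction n with
    | zero => simp
    | succ n ih =>
      rw [Function.iterate_succ_apply', hf]
      simp only [T1, hx, ih]
      rw [pow_succ, div_div]
  have itz : ∀ v (n : ℕ), (f^[n] v).2.2 = 2 ^ n * v.2.2 := by
    intro v n
    induction n with
    | zero => simp
    | succ n ih =>
      rw [Function.iterate_succ_apply', hf]
      simp only [T1, hz, ih]
      ring
  have hstep : ∀ x : ℝ, ∃ P : ℝ → ℝ, Continuous P ∧ (∀ y, P y ∈ Icc (0:ℝ) 1) ∧
      (∃ U, ∀ y, U < |y| → P y = 0) ∧ (∀ y, P y = 1 ↔ ∃ k, (x, y, 0) ∈ Ek r k) ∧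
      ∀ (y : ℝ) (n : ℕ), ∃ η : ℝ → ℝ, η 0 = (f^[n] (x, y, 0)).2.1 ∧
        (f^[n+1] (x, y, 0)).2.1 = 2 * η 1 ∧
        ∀ t, HasDerivAt η (-(P (2 ^ n * η t) * η t * Real.log 4)) t := by
    intro x
    obtain ⟨P, h1, h2, h3, h4, h5⟩ := exists_P r hr ρ hρs.continuous hρ01 hρE hρ0 X hX hX0 x
    refine ⟨P, h1, h2, h3, h4, fun y n => ?_⟩
    set v := f^[n] (x, y, 0) with hv
    refine ⟨fun t => (φ t v).2.1, by simp [hφ0], ?_, fun t => ?_⟩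
    · rw [Function.iterate_succ_apply', hf]
      rfl
    · have e : φ t v = (x / 2 ^ n, (φ t v).2.1, 0) := by
        ext
        · rw [hx, hv, itx]
        · rfl
        · rw [hz, hv, itz]; simp
      have := hd2 v t
      rw [e, h5] at this
      exact this
  have ity0 : ∀ x (n : ℕ), (f^[n] (x, 0, 0)).2.1 = 0 := by
    intro x n
    obtain ⟨P, h1, h2, h3, h4, h5⟩ := hstep x
    induction n with
    | zero => simp
    | succ n ih =>
      obtain ⟨η, e0, e1, hη⟩ := h5 0 n
      rw [e1, aux_zero η (fun t => P (2 ^ n * η t)) hη (fun t => h2 _) (by rw [e0, ih]), mul_zero]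
  have it0 : ∀ n : ℕ, f^[n] ((0, 0, 0) : ℝ × ℝ × ℝ) = 0 := by
    intro n
    ext
    · rw [itx]; simp
    · rw [ity0]; simp
    · rw [itz]; simp
  have hWs : ∀ b, b ∈ Ws f ((0, 0, 0) : ℝ × ℝ × ℝ) ↔
      Tendsto (fun n : ℕ => f^[n] b) atTop (𝓝 0) := by
    intro b
    rw [tendsto_zero_iff_norm_tendsto_zero]
    simp only [Ws, it0, zero_sub, norm_neg]
    rfl
  have hxlim : ∀ x : ℝ, Tendsto (fun n : ℕ => x / 2 ^ n) atTop (𝓝 0) := by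
    intro x
    have := (tendsto_pow_atTop_nhds_zero_of_lt_one (r := (1/2 : ℝ)) (by norm_num)
      (by norm_num)).const_mul x
    simp only [mul_zero] at this
    refine this.congr fun n => ?_
    rw [div_pow, one_pow, mul_one_div]
  have hback : ∀ x y : ℝ, Tendsto (fun n : ℕ => (f^[n] (x, y, 0)).2.1) atTop (𝓝 0) →
      (x, y, (0:ℝ)) ∈ Ws f ((0, 0, 0) : ℝ × ℝ × ℝ) := by
    intro x y h
    rw [hWs]
    have := (hxlim x).prodMk_nhds (h.prodMk_nhds (tendsto_const_nhds (x := (0:ℝ))))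
    refine this.congr fun n => ?_
    ext
    · rw [itx]
    · rfl
    · rw [itz]; simp
  ext ⟨x, y, z⟩
  constructor
  · intro h
    rw [hWs] at h
    have hy : Tendsto (fun n : ℕ => (f^[n] (x, y, z)).2.1) atTop (𝓝 0) :=
      ((continuous_fst.comp continuous_snd).tendsto (0 : ℝ × ℝ × ℝ)).comp h
    have hzl : Tendsto (fun n : ℕ => (f^[n] (x, y, z)).2.2) atTop (𝓝 0) :=
      ((continuous_snd.comp continuous_snd).tendsto (0 : ℝ × ℝ × ℝ)).comp h
    have z0 : z = 0 := by
      by_contra hne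
      have h1 := hzl.abs.eventually (gt_mem_nhds (show |(0:ℝ)| < |z| by simpa using hne))
      obtain ⟨n, hn⟩ := h1.exists
      rw [itz, abs_mul, abs_of_pos (show (0:ℝ) < 2 ^ n by positivity)] at hn
      have : (1:ℝ) ≤ 2 ^ n := one_le_pow₀ (by norm_num)
      simp only at hn
      nlinarith [abs_nonneg z]
    subst z0
    by_cases y0 : y = 0
    · exact Or.inr ⟨y0, rfl⟩
    · left
      rw [mem_iUnion]
      obtain ⟨P, h1, h2, ⟨U, hU⟩, h4, h5⟩ := hstep x
      obtain ⟨a, ha, hPa⟩ := aux_seq (fun u => P (y * u)) (by fun_prop) (fun t => h2 _)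
        (U / |y| + 0) (by
          intro u hu
          apply hU
          rw [abs_mul]
          have hy0 : 0 < |y| := abs_pos.2 y0
          rw [add_zero, div_lt_iff₀ hy0] at hu
          nlinarith [le_abs_self u])
        (fun n => 2 ^ n * (f^[n] (x, y, 0)).2.1 / y) (by simp [y0]) (by
          intro n
          obtain ⟨η, e0, e1, hη⟩ := h5 y n
          refine ⟨fun t => 2 ^ n * η t / y, ?_, ?_, fun t => ?_⟩
          · simp only [e0]
          · simp only [e1]; ring
          · have := ((hη t).const_mul (2 ^ n)).div_const y
            refine this.congr_deriv ?_
            have e : y * (2 ^ n * η t / y) = 2 ^ n * η t := by field_simp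
            simp only [e]
            ring) (by
          have := hy.div_const y
          rw [zero_div] at this
          refine this.congr fun n => ?_
          field_simp)
      obtain ⟨k, hk⟩ := (h4 _).1 hPa
      refine ⟨k, ?_⟩
      have ha0 : a ≠ 0 := by linarith
      have := Ek_vert r k x (y * a) 0 a⁻¹ ⟨by positivity, inv_le_one_of_one_le₀ ha⟩ hk
      rwa [mul_comm y, inv_mul_cancel_left₀ ha0] at this
  · intro h
    by_cases y0 : y = 0
    · subst y0
      have z0 : z = 0 := by
        rcases h with h | h
        · obtain ⟨k, hk⟩ := mem_iUnion.1 h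
          exact Ek_z r hr k _ _ _ hk
        · exact h.2
      subst z0
      apply hback
      simp only [ity0]
      exact tendsto_const_nhds
    · rcases h with h | h
      · obtain ⟨k, hk⟩ := mem_iUnion.1 h
        obtain rfl := Ek_z r hr k _ _ _ hk
        apply hback
        obtain ⟨P, h1, h2, -, h4, h5⟩ := hstep x
        refine (hxlim y).congr fun n => ?_
        induction n with
        | zero => simp
        | succ n ih =>
          obtain ⟨η, e0, e1, hη⟩ := h5 y n
          have := aux_const (fun u => P (y * u)) (fun t => h2 _) (by
            intro t ht
            exact (h4 _).2 ⟨k, by rw [mul_comm]; exact Ek_vert r k x y 0 t ht hk⟩)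
            (fun t => 2 ^ n * η t / y) (by
              simp only [e0, ← ih]
              field_simp) (by
              intro t
              have := ((hη t).const_mul (2 ^ n)).div_const y
              refine this.congr_deriv ?_
              have e : y * (2 ^ n * η t / y) = 2 ^ n * η t := by field_simp
              simp only [e]
              ring)
          rw [e1]
          field_simp at this ⊢
          rw [pow_succ]
          linarith
      · exact absurd h.1 y0
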